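/- For any density matrices ρ₁, ρ₂, ρ₃ on ℂ^N and any α ∈ [0,1], the superfidelity is concave in its second argument: G(ρ₁, αρ₂ + (1−α)ρ₃) ≥ α·G(ρ₁,ρ₂) + (1−α)·G(ρ₁,ρ₃). -/

import Mathlib

open Matrix ComplexOrder

/-- The superfidelity `G(ρ₁,ρ₂) = tr(ρ₁ρ₂) + √(1 - tr ρ₁²) √(1 - tr ρ₂²)`. -/
noncomputable def superFid {n : Type*} [Fintype n] [DecidableEq n]
    (ρ₁ ρ₂ : Matrix n n ℂ) : ℝ :=
  ((ρ₁ * ρ₂).trace).re +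
    Real.sqrt (1 - ((ρ₁ * ρ₁).trace).re) * Real.sqrt (1 - ((ρ₂ * ρ₂).trace).re)

/-- The purity `tr ρ²` of a positive semidefinite matrix is at most `(tr ρ)²`. -/
theorem Matrix.PosSemidef.re_trace_mul_self_le {n : Type*} [Fintype n] [DecidableEq n]
    {A : Matrix n n ℂ} (hA : A.PosSemidef) :
    ((A * A).trace).re ≤ (A.trace.re) ^ 2 := by
  have hsq : (A * A).trace = ∑ i, ((hA.isHermitian.eigenvalues i : ℂ)) ^ 2 := by
    have h := hA.isHermitian.spectral_theorem
    conv_lhs => rw [h]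
    rw [← map_mul, Unitary.conjStarAlgAut_apply, Matrix.trace_mul_cycle,
      Unitary.coe_star_mul_self, one_mul, Matrix.diagonal_mul_diagonal, Matrix.trace_diagonal]
    simp [sq]
  have htr : A.trace.re = ∑ i, hA.isHermitian.eigenvalues i := by
    rw [hA.isHermitian.trace_eq_sum_eigenvalues]
    simp
  have hre : ((A * A).trace).re = ∑ i, hA.isHermitian.eigenvalues i ^ 2 := by
    rw [hsq]
    norm_cast
  rw [hre, htr]
  exact Finset.sum_sq_le_sq_sum_of_nonneg fun i _ => hA.eigenvalues_nonneg i

/-- For Hermitian matrices, `2 tr (AB) ≤ tr A² + tr B²`. -/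
theorem Matrix.IsHermitian.two_mul_re_trace_mul_le {n : Type*} [Fintype n]
    {A B : Matrix n n ℂ} (hA : A.IsHermitian) (hB : B.IsHermitian) :
    2 * ((A * B).trace).re ≤ ((A * A).trace).re + ((B * B).trace).re := by
  have h := (Complex.le_def.1 (posSemidef_conjTranspose_mul_self (A - B)).trace_nonneg).1
  rw [(hA.sub hB).eq] at h
  simp only [sub_mul, mul_sub, trace_sub, Complex.sub_re, Complex.zero_re,
    trace_mul_comm B A] at h
  linarith

/-- Concavity inequality behind `ρ ↦ √(1 - tr ρ²)`, with `a`, `b`, `c` standing for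
`tr ρ²`, `tr σ²`, `tr (ρσ)`. -/
theorem convexComb_sqrt_one_sub_le {a b c α : ℝ} (ha : a ≤ 1) (hb : b ≤ 1)
    (hc : 2 * c ≤ a + b) (hα0 : 0 ≤ α) (hα1 : α ≤ 1) :
    α * √(1 - a) + (1 - α) * √(1 - b) ≤
      √(1 - (α ^ 2 * a + 2 * (α * (1 - α)) * c + (1 - α) ^ 2 * b)) := by
  apply Real.le_sqrt_of_sq_le
  have hsa := Real.sq_sqrt (sub_nonneg.2 ha)
  have hsb := Real.sq_sqrt (sub_nonneg.2 hb)
  have hst : √(1 - a) * √(1 - b) ≤ 1 - c := by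
    nlinarith [sq_nonneg (√(1 - a) - √(1 - b))]
  have hmul := mul_le_mul_of_nonneg_left hst (mul_nonneg hα0 (sub_nonneg.2 hα1))
  calc (α * √(1 - a) + (1 - α) * √(1 - b)) ^ 2
      = α ^ 2 * √(1 - a) ^ 2 + (1 - α) ^ 2 * √(1 - b) ^ 2
        + 2 * (α * (1 - α) * (√(1 - a) * √(1 - b))) := by ring
    _ ≤ _ := by rw [hsa, hsb]; linarith

theorem superFid_concave_second {N : ℕ} (ρ₁ ρ₂ ρ₃ : Matrix (Fin N) (Fin N) ℂ)
    (h₁ : ρ₁.PosSemidef) (h₁' : ρ₁.trace = 1)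
    (h₂ : ρ₂.PosSemidef) (h₂' : ρ₂.trace = 1)
    (h₃ : ρ₃.PosSemidef) (h₃' : ρ₃.trace = 1)
    (α : ℝ) (hα0 : 0 ≤ α) (hα1 : α ≤ 1) :
    superFid ρ₁ ((α : ℂ) • ρ₂ + ((1 - α : ℝ) : ℂ) • ρ₃) ≥
      α * superFid ρ₁ ρ₂ + (1 - α) * superFid ρ₁ ρ₃ := by
  have ha : ((ρ₂ * ρ₂).trace).re ≤ 1 := by simpa [h₂'] using h₂.re_trace_mul_self_le
  have hb : ((ρ₃ * ρ₃).trace).re ≤ 1 := by simpa [h₃'] using h₃.re_trace_mul_self_le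
  have hconc := convexComb_sqrt_one_sub_le ha hb
    (h₂.isHermitian.two_mul_re_trace_mul_le h₃.isHermitian) hα0 hα1
  have hlin : ((ρ₁ * ((α : ℂ) • ρ₂ + ((1 - α : ℝ) : ℂ) • ρ₃)).trace).re =
      α * ((ρ₁ * ρ₂).trace).re + (1 - α) * ((ρ₁ * ρ₃).trace).re := by
    simp only [mul_add, mul_smul_comm, trace_add, trace_smul, smul_eq_mul, Complex.add_re,
      Complex.re_ofReal_mul]
  have hquad : ((((α : ℂ) • ρ₂ + ((1 - α : ℝ) : ℂ) • ρ₃) *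
      ((α : ℂ) • ρ₂ + ((1 - α : ℝ) : ℂ) • ρ₃)).trace).re =
      α ^ 2 * ((ρ₂ * ρ₂).trace).re + 2 * (α * (1 - α)) * ((ρ₂ * ρ₃).trace).re +
        (1 - α) ^ 2 * ((ρ₃ * ρ₃).trace).re := by
    simp only [mul_add, add_mul, mul_smul_comm, smul_mul_assoc, trace_add, trace_smul,
      smul_eq_mul, Complex.add_re, Complex.re_ofReal_mul, trace_mul_comm ρ₃ ρ₂]
    ring
  have hmul := mul_le_mul_of_nonneg_left hconc
    (Real.sqrt_nonneg (1 - ((ρ₁ * ρ₁).trace).re))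
  rw [superFid, superFid, superFid, hlin, hquad]
  linarith
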